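/- arXiv:1511.07666 — 2 statements merged into one kernel-verified Lean document; each statement's English description precedes it below -/
import Mathlib

section
/- Let λ⁺, λ⁻ > 0 and α₁⁺, α₂⁺, α₁⁻, α₂⁻ ≥ 2. For i = 1, 2 define cᵢ : ℝ → ℝ by cᵢ(y) = −(|y| λ⁻)^{1/αᵢ⁻} for y ≤ −1/λ⁻, cᵢ(y) = (y λ⁺)^{1/αᵢ⁺} for y ≥ 1/λ⁺, and cᵢ(y) = 0 otherwise (these are the transportation functions of two-sided polynomial Lévy measures with tail exponents αᵢ^± and intensities λ^±). Then there exists a constant D = D(λ⁺, λ⁻) > 0, not depending on the exponents, such that ∫_ℝ (|c₁(y) − c₂(y)| ∧ 1) y^{−2} dy ≤ D (|α₁⁺ − α₂⁺| + |α₁⁻ − α₂⁻|); i.e. the transportation distance of order 1 between the two measures is bounded by D (|α₁⁺ − α₂⁺| + |α₁⁻ − α₂⁻|). -/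
open MeasureTheory Set

/-- The symmetric Cauchy measure `Π₀(dy) = y⁻² dy` on `ℝ ∖ {0}`. -/
noncomputable def Pi0 : Measure ℝ :=
  volume.withDensity (fun y => ENNReal.ofReal (1 / y ^ 2))

/-- The transportation function of a two-sided polynomial Lévy measure with tail
exponents `ap, am` and intensities `lp, lm`:
`c(y) = -(|y|λ⁻)^{1/α⁻}` for `y ≤ -1/λ⁻`, `c(y) = (yλ⁺)^{1/α⁺}` for `y ≥ 1/λ⁺`,
and `c(y) = 0` otherwise. -/
noncomputable def cPoly (lp lm ap am : ℝ) (y : ℝ) : ℝ :=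
  if y ≤ -(1 / lm) then -((|y| * lm) ^ (1 / am))
  else if 1 / lp ≤ y then (y * lp) ^ (1 / ap)
  else 0

/-- On `[1, ∞)` the power `x ^ (1 / a)` is Lipschitz in the exponent `a ≥ 2`. -/
theorem abs_rpow_one_div_sub_le {x a b : ℝ} (hx : 1 ≤ x) (ha : 2 ≤ a) (hb : 2 ≤ b) :
    |x ^ (1 / a) - x ^ (1 / b)| ≤ |a - b| * x ^ (3 / 4 : ℝ) := by
  wlog hab : a ≤ b generalizing a b
  · rw [abs_sub_comm, abs_sub_comm a]
    exact this hb ha (le_of_not_ge hab)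
  have hx0 : 0 < x := by linarith
  have hinv : 1 / b ≤ 1 / a := one_div_le_one_div_of_le (by linarith) hab
  have hmono : x ^ (1 / b) ≤ x ^ (1 / a) := Real.rpow_le_rpow_of_exponent_le hx hinv
  rw [abs_of_nonneg (sub_nonneg.2 hmono), abs_sub_comm, abs_of_nonneg (sub_nonneg.2 hab)]
  have hgap : 1 / a - 1 / b ≤ (b - a) / 4 := by
    rw [div_sub_div _ _ (by linarith) (by linarith), one_mul, mul_one]
    exact div_le_div_of_nonneg_left (by linarith) (by norm_num) (by nlinarith)
  have hlog : Real.log x ≤ 4 * x ^ (1 / 4 : ℝ) := by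
    have := Real.log_le_rpow_div hx0.le (show (0 : ℝ) < 1 / 4 by norm_num)
    linarith
  have hfactor : x ^ (1 / b) = x ^ (1 / a) * Real.exp (Real.log x * (1 / b - 1 / a)) := by
    rw [← Real.rpow_def_of_pos hx0, ← Real.rpow_add hx0]
    congr 1
    ring
  have hexp := Real.add_one_le_exp (Real.log x * (1 / b - 1 / a))
  have hhalf : x ^ (1 / a) ≤ x ^ (1 / 2 : ℝ) :=
    Real.rpow_le_rpow_of_exponent_le hx (one_div_le_one_div_of_le (by norm_num) ha)
  have hlog0 : 0 ≤ Real.log x := Real.log_nonneg hx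
  calc x ^ (1 / a) - x ^ (1 / b)
      = x ^ (1 / a) * (1 - Real.exp (Real.log x * (1 / b - 1 / a))) := by rw [hfactor]; ring
    _ ≤ x ^ (1 / a) * (Real.log x * (1 / a - 1 / b)) := by
        gcongr
        linarith
    _ ≤ x ^ (1 / 2 : ℝ) * (4 * x ^ (1 / 4 : ℝ) * ((b - a) / 4)) := by
        gcongr
    _ = (b - a) * (x ^ (1 / 2 : ℝ) * x ^ (1 / 4 : ℝ)) := by ring
    _ = (b - a) * x ^ (3 / 4 : ℝ) := by
        rw [← Real.rpow_add hx0]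
        norm_num

theorem inv_sq_mul_rpow_le {l u : ℝ} (hl : 0 < l) (hu : 1 / l ≤ u) :
    1 / u ^ 2 * (u * l) ^ (3 / 4 : ℝ)
      ≤ l ^ (3 / 4 : ℝ) * (1 + l) ^ (5 / 4 : ℝ) * (1 + u) ^ (-(5 / 4) : ℝ) := by
  have hu0 : 0 < u := (one_div_pos.2 hl).trans_le hu
  have hul : 1 ≤ u * l := (div_le_iff₀ hl).1 hu
  have hpow : 1 / u ^ 2 * u ^ (3 / 4 : ℝ) = u ^ (-(5 / 4) : ℝ) := by
    rw [one_div, ← Real.rpow_natCast, ← Real.rpow_neg hu0.le, ← Real.rpow_add hu0]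
    norm_num
  have hbase : (u * (1 + l)) ^ (-(5 / 4) : ℝ) ≤ (1 + u) ^ (-(5 / 4) : ℝ) :=
    Real.rpow_le_rpow_of_nonpos (by linarith) (by linarith) (by norm_num)
  calc 1 / u ^ 2 * (u * l) ^ (3 / 4 : ℝ)
      = l ^ (3 / 4 : ℝ) * u ^ (-(5 / 4) : ℝ) := by
        rw [Real.mul_rpow hu0.le hl.le, ← hpow]
        ring
    _ = l ^ (3 / 4 : ℝ) * (1 + l) ^ (5 / 4 : ℝ) * (u * (1 + l)) ^ (-(5 / 4) : ℝ) := by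
        have hl1 : 0 < (1 + l) ^ (5 / 4 : ℝ) := by positivity
        rw [Real.mul_rpow hu0.le (by linarith), Real.rpow_neg (show 0 ≤ 1 + l by linarith)]
        field_simp
    _ ≤ _ := by gcongr

/-- Weighted by the density of `Pi0`, the difference of the powers on a half-line `u ≥ 1 / l` is
dominated by an integrable function. -/
theorem inv_sq_mul_abs_rpow_sub_le {l u a b : ℝ} (hl : 0 < l) (hu : 1 / l ≤ u)
    (ha : 2 ≤ a) (hb : 2 ≤ b) :
    1 / u ^ 2 * |(u * l) ^ (1 / a) - (u * l) ^ (1 / b)|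
      ≤ |a - b| * (l ^ (3 / 4 : ℝ) * (1 + l) ^ (5 / 4 : ℝ) * (1 + u) ^ (-(5 / 4) : ℝ)) :=
  calc 1 / u ^ 2 * |(u * l) ^ (1 / a) - (u * l) ^ (1 / b)|
      ≤ 1 / u ^ 2 * (|a - b| * (u * l) ^ (3 / 4 : ℝ)) := by
        gcongr
        exact abs_rpow_one_div_sub_le ((div_le_iff₀ hl).1 hu) ha hb
    _ = |a - b| * (1 / u ^ 2 * (u * l) ^ (3 / 4 : ℝ)) := by ring
    _ ≤ _ := mul_le_mul_of_nonneg_left (inv_sq_mul_rpow_le hl hu) (abs_nonneg _)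

theorem inv_sq_mul_abs_cPoly_sub_le {lp lm : ℝ} (hlp : 0 < lp) (hlm : 0 < lm)
    {a1p a2p a1m a2m : ℝ} (h1p : 2 ≤ a1p) (h2p : 2 ≤ a2p) (h1m : 2 ≤ a1m) (h2m : 2 ≤ a2m)
    (y : ℝ) :
    1 / y ^ 2 * |cPoly lp lm a1p a1m y - cPoly lp lm a2p a2m y|
      ≤ (lp ^ (3 / 4 : ℝ) * (1 + lp) ^ (5 / 4 : ℝ) + lm ^ (3 / 4 : ℝ) * (1 + lm) ^ (5 / 4 : ℝ))
        * (|a1p - a2p| + |a1m - a2m|) * (1 + ‖y‖) ^ (-(5 / 4) : ℝ) := by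
  have hw : 0 ≤ (1 + |y|) ^ (-(5 / 4) : ℝ) := by positivity
  have hCp : 0 ≤ lp ^ (3 / 4 : ℝ) * (1 + lp) ^ (5 / 4 : ℝ) := by positivity
  have hCm : 0 ≤ lm ^ (3 / 4 : ℝ) * (1 + lm) ^ (5 / 4 : ℝ) := by positivity
  have hp := abs_nonneg (a1p - a2p)
  have hm := abs_nonneg (a1m - a2m)
  rw [Real.norm_eq_abs]
  unfold cPoly
  split_ifs with hneg hpos
  · have hlm' : 0 < 1 / lm := one_div_pos.2 hlm
    have hy : 1 / lm ≤ |y| := by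
      rw [abs_of_neg (by linarith)]
      linarith
    have key := inv_sq_mul_abs_rpow_sub_le hlm hy h1m h2m
    rw [neg_sub_neg, abs_sub_comm, ← sq_abs y]
    refine key.trans ?_
    rw [← mul_assoc]
    gcongr ?_ * _
    rw [mul_comm]
    gcongr <;> linarith
  · have hlp' : 0 < 1 / lp := one_div_pos.2 hlp
    have key := inv_sq_mul_abs_rpow_sub_le hlp hpos h1p h2p
    rw [abs_of_pos (hlp'.trans_le hpos)] at hw ⊢
    refine key.trans ?_
    rw [← mul_assoc]
    gcongr ?_ * _
    rw [mul_comm]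
    gcongr <;> linarith
  · simp only [sub_self, abs_zero, mul_zero]
    positivity

/-- `T₁`-Lipschitz bound in the tail exponents for two-sided polynomial Lévy measures,
with a constant depending only on the intensities `λ⁺, λ⁻`. -/
theorem polynomial_T1_lipschitz_in_exponents (lp lm : ℝ) (hlp : 0 < lp) (hlm : 0 < lm) :
    ∃ D > (0 : ℝ), ∀ a1p a2p a1m a2m : ℝ,
      2 ≤ a1p → 2 ≤ a2p → 2 ≤ a1m → 2 ≤ a2m →
      (∫⁻ y, ENNReal.ofReal
          (min |cPoly lp lm a1p a1m y - cPoly lp lm a2p a2m y| 1) ∂Pi0)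
        ≤ ENNReal.ofReal (D * (|a1p - a2p| + |a1m - a2m|)) := by
  set C := lp ^ (3 / 4 : ℝ) * (1 + lp) ^ (5 / 4 : ℝ) + lm ^ (3 / 4 : ℝ) * (1 + lm) ^ (5 / 4 : ℝ)
  have hC0 : 0 < C := by positivity
  have hint : Integrable (fun y : ℝ => (1 + ‖y‖) ^ (-(5 / 4) : ℝ)) :=
    integrable_one_add_norm (by norm_num)
  have hI0 : 0 ≤ ∫ y : ℝ, (1 + ‖y‖) ^ (-(5 / 4) : ℝ) := integral_nonneg fun y => by positivity
  set I := ∫ y : ℝ, (1 + ‖y‖) ^ (-(5 / 4) : ℝ)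
  refine ⟨C * (I + 1), by positivity, fun a1p a2p a1m a2m h1p h2p h1m h2m => ?_⟩
  set Δ := |a1p - a2p| + |a1m - a2m|
  have hΔ0 : 0 ≤ Δ := by positivity
  calc _ ≤ ∫⁻ y : ℝ, ENNReal.ofReal (1 / y ^ 2) * ENNReal.ofReal
          (min |cPoly lp lm a1p a1m y - cPoly lp lm a2p a2m y| 1) :=
        lintegral_withDensity_le_lintegral_mul _ (by fun_prop) _
    _ ≤ ∫⁻ y : ℝ, ENNReal.ofReal (C * Δ * (1 + ‖y‖) ^ (-(5 / 4) : ℝ)) := by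
        refine lintegral_mono fun y => ?_
        rw [← ENNReal.ofReal_mul (by positivity)]
        refine ENNReal.ofReal_le_ofReal (le_trans ?_
          (inv_sq_mul_abs_cPoly_sub_le hlp hlm h1p h2p h1m h2m y))
        gcongr
        exact min_le_left _ _
    _ = ENNReal.ofReal (C * Δ * I) := by
        rw [← ofReal_integral_eq_lintegral_ofReal (hint.const_mul _)
          (Filter.Eventually.of_forall fun y => by positivity), integral_const_mul]
    _ ≤ ENNReal.ofReal (C * (I + 1) * Δ) := by
        refine ENNReal.ofReal_le_ofReal ?_
        nlinarith [mul_nonneg hC0.le hΔ0]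
end

section
/- Let λ⁺, λ⁻ > 0 and let α : ℝ → [2, ∞) be bounded and Lipschitz continuous. For x ∈ ℝ define c(x, ·) : ℝ → ℝ by c(x, y) = −(|y| λ⁻)^{1/α(x)} for y ≤ −1/λ⁻, c(x, y) = (y λ⁺)^{1/α(x)} for y ≥ 1/λ⁺, and c(x, y) = 0 otherwise (the transportation function of the two-sided polynomial Lévy kernel with state-dependent tail exponent α(x)). Then there exists L_Π > 0 such that for all x, x' ∈ ℝ: ∫_ℝ (|c(x, y) − c(x', y)| ∧ 1) y^{−2} dy ≤ L_Π (|x − x'| ∧ 1); i.e. the kernel satisfies the T₁-Lipschitz condition with respect to the truncated distance ρ(x, x') = |x − x'| ∧ 1. -/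
open MeasureTheory Set

/-- The transportation function of the two-sided polynomial Lévy kernel with
state-dependent tail exponent `α(x)` and intensities `lp = λ⁺`, `lm = λ⁻`:
`c(x,y) = -(|y|λ⁻)^{1/α(x)}` for `y ≤ -1/λ⁻`, `c(x,y) = (yλ⁺)^{1/α(x)}` for
`y ≥ 1/λ⁺`, and `c(x,y) = 0` otherwise. -/
noncomputable def cKernel (lp lm : ℝ) (α : ℝ → ℝ) (x y : ℝ) : ℝ :=
  if y ≤ -(1 / lm) then -((|y| * lm) ^ (1 / α x))
  else if 1 / lp ≤ y then (y * lp) ^ (1 / α x)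
  else 0

/-- On `[1, ∞)` the power `u ^ a` is Lipschitz in the exponent `a ≤ 1/2`, with a constant of order
`u ^ (3/4)`. -/
lemma abs_rpow_sub_rpow_le {u a b : ℝ} (hu : 1 ≤ u) (ha : a ≤ 1 / 2) (hb : b ≤ 1 / 2) :
    |u ^ a - u ^ b| ≤ 4 * |a - b| * u ^ (3 / 4 : ℝ) := by
  wlog hab : b ≤ a generalizing a b
  · rw [abs_sub_comm, abs_sub_comm a b]
    exact this hb ha (le_of_not_ge hab)
  have hu0 : 0 < u := by linarith
  have hmono : u ^ b ≤ u ^ a := Real.rpow_le_rpow_of_exponent_le hu hab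
  rw [abs_of_nonneg (sub_nonneg.2 hmono), abs_of_nonneg (sub_nonneg.2 hab)]
  have hlog : Real.log u ≤ 4 * u ^ (1 / 4 : ℝ) := by
    have h := Real.log_le_rpow_div hu0.le (ε := 1 / 4) (by norm_num)
    linarith
  have hfac : u ^ b = u ^ a * Real.exp (-((a - b) * Real.log u)) := by
    rw [Real.rpow_def_of_pos hu0, Real.rpow_def_of_pos hu0, ← Real.exp_add]
    congr 1
    ring
  have hexp := Real.add_one_le_exp (-((a - b) * Real.log u))
  have hab0 : 0 ≤ a - b := sub_nonneg.2 hab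
  calc u ^ a - u ^ b
      = u ^ a * (1 - Real.exp (-((a - b) * Real.log u))) := by rw [hfac]; ring
    _ ≤ u ^ a * ((a - b) * Real.log u) := by gcongr; linarith
    _ ≤ u ^ (1 / 2 : ℝ) * ((a - b) * (4 * u ^ (1 / 4 : ℝ))) := by
        have := Real.log_nonneg hu
        gcongr
    _ = 4 * (a - b) * (u ^ (1 / 2 : ℝ) * u ^ (1 / 4 : ℝ)) := by ring
    _ = 4 * (a - b) * u ^ (3 / 4 : ℝ) := by
        rw [← Real.rpow_add hu0]
        norm_num

/-- Reciprocal exponents `p, q ≥ 2` turn `abs_rpow_sub_rpow_le` into a Lipschitz bound in `p`. -/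
lemma abs_rpow_one_div_sub_le_s17 {u p q : ℝ} (hu : 1 ≤ u) (hp : 2 ≤ p) (hq : 2 ≤ q) :
    |u ^ (1 / p) - u ^ (1 / q)| ≤ |p - q| * u ^ (3 / 4 : ℝ) := by
  have hp' : 1 / p ≤ 1 / 2 := one_div_le_one_div_of_le (by norm_num) hp
  have hq' : 1 / q ≤ 1 / 2 := one_div_le_one_div_of_le (by norm_num) hq
  refine (abs_rpow_sub_rpow_le hu hp' hq').trans ?_
  have hpq : 4 * |1 / p - 1 / q| ≤ |p - q| := by
    have hp0 : 0 < p := by linarith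
    have hq0 : 0 < q := by linarith
    have h4 : 4 ≤ p * q := by nlinarith
    rw [div_sub_div _ _ hp0.ne' hq0.ne', abs_div, abs_of_pos (mul_pos hp0 hq0), one_mul, mul_one,
      abs_sub_comm q p, mul_div_assoc', div_le_iff₀ (mul_pos hp0 hq0)]
    nlinarith [abs_nonneg (p - q)]
  gcongr

/-- A tail of order `3/4` is dominated, relative to the Cauchy density, by an integrable power. -/
lemma rpow_mul_cauchy_density_le {l y : ℝ} (hl : 0 < l) (hy : 1 ≤ |y| * l) :
    1 / y ^ 2 * (|y| * l) ^ (3 / 4 : ℝ) ≤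
      l ^ 2 * (1 + 1 / l) ^ (5 / 4 : ℝ) * (1 + |y|) ^ (-(5 / 4) : ℝ) := by
  have hu : 0 < |y| * l := by linarith
  have hy0 : 0 < |y| := pos_of_mul_pos_left hu hl.le
  have hle : 1 + |y| ≤ (1 + 1 / l) * (|y| * l) := by
    have : (1 + 1 / l) * (|y| * l) = |y| * l + |y| := by field_simp
    linarith
  have hpow : (|y| * l) ^ (-(5 / 4) : ℝ) ≤
      (1 + 1 / l) ^ (5 / 4 : ℝ) * (1 + |y|) ^ (-(5 / 4) : ℝ) := by
    rw [Real.rpow_neg hu.le, Real.rpow_neg (by positivity), ← div_eq_mul_inv, inv_eq_one_div,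
      div_le_div_iff₀ (by positivity) (by positivity), one_mul,
      ← Real.mul_rpow (by positivity) hu.le]
    gcongr
  have heq : 1 / y ^ 2 * (|y| * l) ^ (3 / 4 : ℝ) = l ^ 2 * (|y| * l) ^ (-(5 / 4) : ℝ) := by
    have h : (|y| * l) ^ (3 / 4 : ℝ) = (|y| * l) ^ (-(5 / 4) : ℝ) * (|y| * l) ^ 2 := by
      rw [← Real.rpow_natCast, ← Real.rpow_add hu]
      norm_num
    have hy2 : y ≠ 0 := abs_pos.1 hy0
    rw [h, mul_pow, sq_abs]
    field_simp
  rw [heq, mul_assoc]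
  gcongr

/-- Truncating `d * U` at `1` costs at most the factor `U ≥ 1` on the truncation of `d`. -/
lemma min_one_le_of_le_mul {t K d U : ℝ} (hd : 0 ≤ d) (hU : 1 ≤ U) (h : t ≤ K * d * U) :
    min t 1 ≤ max K 1 * min d 1 * U := by
  have hK : 1 ≤ max K 1 := le_max_right _ _
  rcases le_total d 1 with h1 | h1
  · rw [min_eq_left h1]
    refine (min_le_left _ _).trans (h.trans ?_)
    gcongr
    exact le_max_left _ _
  · rw [min_eq_right h1]
    refine (min_le_right _ _).trans ?_
    nlinarith

/-- Pointwise bound for the integrand of the transportation distance against an integrable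
power of `1 + |y|`. -/
lemma cauchy_density_mul_min_cKernel_le {lp lm K : ℝ} (hlp : 0 < lp) (hlm : 0 < lm) {α : ℝ → ℝ}
    (h2 : ∀ x, 2 ≤ α x) (hK : ∀ x x', |α x - α x'| ≤ K * |x - x'|) (x x' y : ℝ) :
    1 / y ^ 2 * min |cKernel lp lm α x y - cKernel lp lm α x' y| 1 ≤
      max K 1 * min |x - x'| 1 *
        ((lp ^ 2 * (1 + 1 / lp) ^ (5 / 4 : ℝ) + lm ^ 2 * (1 + 1 / lm) ^ (5 / 4 : ℝ)) *
          (1 + |y|) ^ (-(5 / 4) : ℝ)) := by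
  have hm : 0 ≤ max K 1 * min |x - x'| 1 := by positivity
  have tail {l t : ℝ} (hl : 0 < l) (hy : 1 ≤ |y| * l)
      (ht : t = |(|y| * l) ^ (1 / α x) - (|y| * l) ^ (1 / α x')|) :
      1 / y ^ 2 * min t 1 ≤ max K 1 * min |x - x'| 1 *
        (l ^ 2 * (1 + 1 / l) ^ (5 / 4 : ℝ) * (1 + |y|) ^ (-(5 / 4) : ℝ)) := by
    have h : t ≤ K * |x - x'| * (|y| * l) ^ (3 / 4 : ℝ) := by
      rw [ht]
      refine (abs_rpow_one_div_sub_le_s17 hy (h2 x) (h2 x')).trans ?_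
      gcongr
      exact hK x x'
    have hU : 1 ≤ (|y| * l) ^ (3 / 4 : ℝ) := Real.one_le_rpow hy (by norm_num)
    calc 1 / y ^ 2 * min t 1
        ≤ 1 / y ^ 2 * (max K 1 * min |x - x'| 1 * (|y| * l) ^ (3 / 4 : ℝ)) := by
          gcongr
          exact min_one_le_of_le_mul (abs_nonneg _) hU h
      _ = max K 1 * min |x - x'| 1 * (1 / y ^ 2 * (|y| * l) ^ (3 / 4 : ℝ)) := by ring
      _ ≤ _ := by
          exact mul_le_mul_of_nonneg_left (rpow_mul_cauchy_density_le hl hy) hm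
  unfold cKernel
  split_ifs with hneg hpos
  · have h0 : 0 < 1 / lm := by positivity
    have hy : 1 ≤ |y| * lm := by
      rw [← div_le_iff₀ hlm]
      linarith [neg_le_abs y]
    refine (tail hlm hy ?_).trans ?_
    · rw [← neg_sub', abs_neg]
    · gcongr
      exact le_add_of_nonneg_left (by positivity)
  · have hy0 : 0 < y := lt_of_lt_of_le (by positivity) hpos
    have hy : 1 ≤ |y| * lp := by
      rwa [abs_of_pos hy0, ← div_le_iff₀ hlp]
    refine (tail hlp hy ?_).trans ?_
    · rw [abs_of_pos hy0]
    · gcongr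
      exact le_add_of_nonneg_right (by positivity)
  · simp only [sub_self, abs_zero, zero_le_one, min_eq_left, mul_zero]
    positivity

/-- The two-sided polynomial Lévy kernel with bounded Lipschitz exponent
`α : ℝ → [2,∞)` satisfies the `T₁`-Lipschitz condition with respect to the
truncated distance `ρ(x,x') = |x-x'| ∧ 1`. -/
theorem polynomial_kernel_T1_lipschitz (lp lm : ℝ) (hlp : 0 < lp) (hlm : 0 < lm)
    (α : ℝ → ℝ) (h2 : ∀ x, 2 ≤ α x) (hbd : ∃ M : ℝ, ∀ x, α x ≤ M)
    (hLip : ∃ K : ℝ, ∀ x x', |α x - α x'| ≤ K * |x - x'|) :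
    ∃ LPi > (0 : ℝ), ∀ x x' : ℝ,
      (∫⁻ y, ENNReal.ofReal (min |cKernel lp lm α x y - cKernel lp lm α x' y| 1) ∂Pi0)
        ≤ ENNReal.ofReal (LPi * min |x - x'| 1) := by
  obtain ⟨K, hK⟩ := hLip
  set C : ℝ := lp ^ 2 * (1 + 1 / lp) ^ (5 / 4 : ℝ) + lm ^ 2 * (1 + 1 / lm) ^ (5 / 4 : ℝ)
  have hC0 : 0 < C := by positivity
  have hint : Integrable (fun y : ℝ => (1 + |y|) ^ (-(5 / 4) : ℝ)) := by
    simpa only [Real.norm_eq_abs] using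
      integrable_one_add_norm (E := ℝ) (μ := volume) (r := 5 / 4) (by norm_num)
  set I : ℝ := ∫ y : ℝ, (1 + |y|) ^ (-(5 / 4) : ℝ)
  have hI0 : 0 ≤ I := integral_nonneg fun y => by positivity
  refine ⟨max K 1 * (C * I) + 1, by positivity, fun x x' => ?_⟩
  have hm : 0 ≤ min |x - x'| 1 := by positivity
  calc ∫⁻ y, ENNReal.ofReal (min |cKernel lp lm α x y - cKernel lp lm α x' y| 1) ∂Pi0
      ≤ ∫⁻ y, ENNReal.ofReal (1 / y ^ 2) *
          ENNReal.ofReal (min |cKernel lp lm α x y - cKernel lp lm α x' y| 1) :=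
        lintegral_withDensity_le_lintegral_mul _ (by fun_prop) _
    _ ≤ ∫⁻ y : ℝ, ENNReal.ofReal
          (max K 1 * min |x - x'| 1 * (C * (1 + |y|) ^ (-(5 / 4) : ℝ))) := by
        refine lintegral_mono fun y => ?_
        rw [← ENNReal.ofReal_mul (by positivity)]
        exact ENNReal.ofReal_le_ofReal
          (cauchy_density_mul_min_cKernel_le hlp hlm h2 hK x x' y)
    _ = ENNReal.ofReal (max K 1 * min |x - x'| 1 * (C * I)) := by
        rw [← ofReal_integral_eq_lintegral_ofReal ((hint.const_mul C).const_mul _)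
          (Filter.Eventually.of_forall fun y => by positivity), integral_const_mul,
          integral_const_mul]
    _ ≤ ENNReal.ofReal ((max K 1 * (C * I) + 1) * min |x - x'| 1) := by
        refine ENNReal.ofReal_le_ofReal ?_
        linarith
end
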